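/- Let M be a closed manifold with dim M ≥ 2 and F = {f_λ : λ ∈ Λ} ⊂ Homeo(M) an IFS. If F is topologically stable, then F has the shadowing property. -/

import Mathlib

open Metric

namespace IFS

variable {M : Type*} [TopologicalSpace M] {Λ : Type*}

/-- Forward composition along `σ`: the time-`n` (n ≥ 0) map of the IFS. -/
def fwdComp (F : Λ → M ≃ₜ M) (σ : ℤ → Λ) : ℕ → M ≃ₜ M
  | 0 => Homeomorph.refl M
  | n + 1 => (fwdComp F σ n).trans (F (σ n))

/-- Backward composition along `σ`: the time-`(-n)` map of the IFS. -/
def bwdComp (F : Λ → M ≃ₜ M) (σ : ℤ → Λ) : ℕ → M ≃ₜ M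
  | 0 => Homeomorph.refl M
  | n + 1 => (bwdComp F σ n).trans (F (σ (-(n + 1 : ℤ)))).symm

/-- The composition `F_{σ_k}` along the symbol sequence `σ`, for `k ∈ ℤ`. -/
def ifsComp (F : Λ → M ≃ₜ M) (σ : ℤ → Λ) : ℤ → M ≃ₜ M
  | Int.ofNat n => fwdComp F σ n
  | Int.negSucc n => bwdComp F σ (n + 1)

/-- The C⁰ distance `ρ₀` between two homeomorphisms. -/
noncomputable def rho0 {M : Type*} [MetricSpace M] (f g : M ≃ₜ M) : ℝ :=
  ⨆ x : M, max (dist (f x) (g x)) (dist (f.symm x) (g.symm x))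

/-- The distance `D₀` between two IFSs indexed by the same set. -/
noncomputable def D0 {M : Type*} [MetricSpace M] {Λ : Type*} (F G : Λ → M ≃ₜ M) : ℝ :=
  ⨆ l : Λ, rho0 (F l) (G l)

end IFS

open IFS

open scoped Manifold

open Topology

/-- Finitely many prescribed values of a continuous curve of vectors, with a uniform bound. -/
lemma exists_continuous_interpolation {ι V : Type*} [Finite ι] [NormedAddCommGroup V]
    [NormedSpace ℝ V] [FiniteDimensional ℝ V] {δ : ℝ} (hδ : 0 < δ) {t : ι → ℝ}
    (ht : Function.Injective t) {v : ι → V} (hv : ∀ i, ‖v i‖ ≤ δ) :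
    ∃ Φ : ℝ → V, Continuous Φ ∧ (∀ s, ‖Φ s‖ ≤ δ) ∧ ∀ i, Φ (t i) = v i := by
  let _ : TopologicalSpace ι := ⊥
  have : DiscreteTopology ι := ⟨rfl⟩
  have he : IsClosedEmbedding t :=
    .of_continuous_injective_isClosedMap continuous_of_discreteTopology ht
      fun s _ => ((Set.toFinite s).image t).isClosed
  obtain ⟨g, hg, hgv⟩ := ContinuousMap.exists_extension_forall_mem he
    (⟨v, continuous_of_discreteTopology⟩ : C(ι, V)) (t := closedBall 0 δ) (by simpa using hv)
    (ht := Metric.instTietzeExtensionClosedBall ℝ 0 hδ)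
  exact ⟨g, g.continuous, by simpa using hg, fun i => congr($hgv i)⟩

/-- A cut-off shear: a bijection of Euclidean space preserving the `j`-th coordinate, supported in a
ball, and moving finitely many points with distinct `j`-th coordinates to prescribed places. -/
lemma exists_shear {n : ℕ} {ι : Type*} [Finite ι] (c : EuclideanSpace ℝ (Fin n)) {ρ δ : ℝ}
    (hδ : 0 < δ) (hδρ : δ < ρ) (j : Fin n) {a b : ι → EuclideanSpace ℝ (Fin n)}
    (hab : ∀ i, ‖b i - a i‖ ≤ δ) (hj : ∀ i, b i j = a i j)
    (hinj : Function.Injective fun i => a i j)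
    (hin : ∀ i, a i = b i ∨ a i ∈ closedBall c (2 * ρ)) :
    ∃ T : EuclideanSpace ℝ (Fin n) ≃ EuclideanSpace ℝ (Fin n), Continuous T ∧
      (∀ x, dist (T x) x ≤ δ) ∧ (∀ x ∉ closedBall c (3 * ρ), T x = x) ∧ ∀ i, T (a i) = b i := by
  have hρ : 0 < ρ := hδ.trans hδρ
  let W : Submodule ℝ (EuclideanSpace ℝ (Fin n)) :=
    LinearMap.ker (EuclideanSpace.proj (𝕜 := ℝ) j).toLinearMap
  have hW : ∀ w : W, (w : EuclideanSpace ℝ (Fin n)) j = 0 := fun w => w.2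
  obtain ⟨Φ, hΦc, hΦ, hΦa⟩ := exists_continuous_interpolation (V := W) hδ hinj
    (v := fun i => ⟨b i - a i, by simp [W, hj]⟩) (by simpa using hab)
  let ψ : EuclideanSpace ℝ (Fin n) → ℝ := fun x => max 0 (min 1 (3 - dist x c / ρ))
  have hψc : Continuous ψ := by fun_prop
  have hψ0 : ∀ x, 0 ≤ ψ x := fun x => le_max_left _ _
  have hψ1 : ∀ x, ψ x ≤ 1 := fun x => max_le zero_le_one (min_le_left _ _)
  have hψin : ∀ x ∈ closedBall c (2 * ρ), ψ x = 1 := by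
    intro x hx
    have : dist x c / ρ ≤ 2 := (div_le_iff₀ hρ).2 hx
    simp only [ψ]
    rw [min_eq_left (by linarith), max_eq_right zero_le_one]
  have hψout : ∀ x ∉ closedBall c (3 * ρ), ψ x = 0 := by
    intro x hx
    have : 3 < dist x c / ρ := (lt_div_iff₀ hρ).2 (not_le.1 hx)
    exact max_eq_left ((min_le_right _ _).trans (by linarith))
  have hψL : ∀ x y, |ψ x - ψ y| ≤ dist x y / ρ := by
    intro x y
    calc |ψ x - ψ y| ≤ |min 1 (3 - dist x c / ρ) - min 1 (3 - dist y c / ρ)| := by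
          simpa using abs_max_sub_max_le_max 0 (min 1 (3 - dist x c / ρ)) 0 (min 1 (3 - dist y c / ρ))
      _ ≤ |(3 - dist x c / ρ) - (3 - dist y c / ρ)| := by
          simpa using abs_min_sub_min_le_max 1 (3 - dist x c / ρ) 1 (3 - dist y c / ρ)
      _ = |dist x c - dist y c| / ρ := by
          rw [← abs_of_pos hρ, ← abs_div, abs_of_pos hρ, ← abs_neg]; congr 1; ring
      _ ≤ dist x y / ρ := by gcongr; exact abs_dist_sub_le x y c
  let f : EuclideanSpace ℝ (Fin n) → EuclideanSpace ℝ (Fin n) := fun x => x + ψ x • (Φ (x j) : _)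
  have hfj : ∀ x, f x j = x j := by intro x; simp [f, hW]
  let K : NNReal := ⟨δ / ρ, by positivity⟩
  have hcontr : ∀ y, ContractingWith K fun x => y - ψ x • (Φ (y j) : EuclideanSpace ℝ (Fin n)) := by
    refine fun y => ⟨by rw [← NNReal.coe_lt_coe]; exact (div_lt_one hρ).2 hδρ, ?_⟩
    refine LipschitzWith.of_dist_le_mul fun x x' => ?_
    rw [dist_sub_left, dist_eq_norm, ← sub_smul, norm_smul, Real.norm_eq_abs]
    calc |ψ x - ψ x'| * ‖(Φ (y j) : EuclideanSpace ℝ (Fin n))‖ ≤ dist x x' / ρ * δ := by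
          gcongr
          · exact hψL x x'
          · exact hΦ _
      _ = K * dist x x' := by change _ = δ / ρ * _; ring
  have hbij : Function.Bijective f := by
    constructor
    · intro x x' h
      have hx : x' j = x j := by rw [← hfj x, ← hfj x', h]
      refine (hcontr (f x)).fixedPoint_unique' ?_ ?_
      · simp [Function.IsFixedPt, hfj, f]
      · rw [Function.IsFixedPt, hfj, h]; simp [f, hx]
    · intro y
      have h := (hcontr y).fixedPoint_isFixedPt
      set x := (hcontr y).fixedPoint
      have hx : x j = y j := by
        have := congr($(h.eq) j)
        simpa [hW] using this.symm
      refine ⟨x, ?_⟩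
      have h' : y - ψ x • (Φ (y j) : EuclideanSpace ℝ (Fin n)) = x := h
      change x + ψ x • (Φ (x j) : EuclideanSpace ℝ (Fin n)) = y
      rw [hx, ← eq_sub_iff_add_eq, h']
  refine ⟨Equiv.ofBijective f hbij, ?_, fun x => ?_, fun x hx => ?_, fun i => ?_⟩
  · change Continuous f
    fun_prop
  · change dist (x + _) x ≤ δ
    rw [dist_self_add_left, norm_smul, Real.norm_of_nonneg (hψ0 x), ← one_mul δ]
    gcongr
    · exact hψ1 x
    · exact hΦ _
  · simp [f, hψout x hx]
  · change a i + ψ (a i) • (Φ (a i j) : EuclideanSpace ℝ (Fin n)) = b i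
    rw [hΦa i]
    rcases hin i with h | h
    · simp [h]
    · simp [hψin _ h]

/-- Two cut-off shears move finitely many points of a ball to nearby ones, provided the sources are
separated by one coordinate and the targets by another. -/
lemma exists_equiv_move {n : ℕ} {ι : Type*} [Finite ι] (c : EuclideanSpace ℝ (Fin n)) {ρ δ : ℝ}
    (hδ : 0 < δ) (hδρ : 2 * δ < ρ) {j k : Fin n} (hjk : j ≠ k)
    {a b : ι → EuclideanSpace ℝ (Fin n)} (hab : ∀ i, ‖b i - a i‖ ≤ δ)
    (ha : Function.Injective fun i => a i j) (hb : Function.Injective fun i => b i k)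
    (hin : ∀ i, a i = b i ∨ a i ∈ closedBall c ρ) :
    ∃ T : EuclideanSpace ℝ (Fin n) ≃ EuclideanSpace ℝ (Fin n), Continuous T ∧
      (∀ x, dist (T x) x ≤ 3 * δ) ∧ (∀ x ∉ closedBall c (3 * ρ), T x = x) ∧
      ∀ i, T (a i) = b i := by
  let w : ι → EuclideanSpace ℝ (Fin n) :=
    fun i => b i + EuclideanSpace.single j (a i j - b i j)
  have hwj : ∀ i, w i j = a i j := by intro i; simp [w]
  have hwk : ∀ i, w i k = b i k := by intro i; simp [w, hjk.symm]
  have hbw : ∀ i, ‖b i - w i‖ ≤ δ := by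
    intro i
    have : ‖(b i - a i) j‖ ≤ ‖b i - a i‖ := PiLp.norm_apply_le _ j
    simp only [w, sub_add_cancel_left, norm_neg, PiLp.norm_single]
    rw [norm_sub_rev]
    exact this.trans (hab i)
  have hwa : ∀ i, ‖w i - a i‖ ≤ 2 * δ := by
    intro i
    have := norm_sub_le_norm_sub_add_norm_sub (w i) (b i) (a i)
    have h1 := hbw i
    have h2 := hab i
    rw [norm_sub_rev] at h1
    linarith
  have hwb : ∀ i, a i = b i → w i = b i := by intro i h; simp [w, h]
  obtain ⟨T, hTc, hTd, hTo, hTa⟩ := exists_shear c (by linarith) hδρ j hwa hwj ha fun i => by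
    refine (hin i).imp (fun h => h.trans (hwb i h).symm) fun h => ?_
    exact closedBall_subset_closedBall (by linarith) h
  obtain ⟨S, hSc, hSd, hSo, hSw⟩ := exists_shear c hδ (by linarith) k hbw
    (fun i => (hwk i).symm) (by simpa only [hwk] using hb) fun i => by
      refine (hin i).imp (hwb i) fun h => ?_
      rw [mem_closedBall] at h ⊢
      have := dist_triangle (w i) (a i) c
      have h2 := hwa i
      rw [← dist_eq_norm] at h2
      linarith
  refine ⟨T.trans S, hSc.comp hTc, fun x => ?_, fun x hx => ?_, fun i => ?_⟩
  · have := dist_triangle (S (T x)) (T x) x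
    have := hSd (T x)
    have := hTd x
    simp only [Equiv.trans_apply]
    linarith
  · simp [hTo x hx, hSo x hx]
  · simp [hTa, hSw]

/-- A bijection of the model space supported in a compact part of a chart extends by the identity. -/
lemma exists_homeomorph_extend {E M : Type*} [TopologicalSpace E] [TopologicalSpace M]
    [CompactSpace M] [T2Space M] (e : OpenPartialHomeomorph M E) {K : Set E} (hK : IsCompact K)
    (hKe : K ⊆ e.target) (T : E ≃ E) (hT : Continuous T) (hTK : ∀ x ∉ K, T x = x) :
    ∃ η : M ≃ₜ M, (∀ z ∈ e.source, η z = e.symm (T (e z))) ∧ ∀ z ∉ e.symm '' K, η z = z := by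
  classical
  have hTsymm : ∀ x ∉ K, T.symm x = x := fun x hx => by rw [Equiv.symm_apply_eq, hTK x hx]
  have hmaps : ∀ S : E ≃ E, (∀ x ∉ K, S x = x) → ∀ x ∈ e.target, S x ∈ e.target := by
    intro S hS x hx
    by_cases h : S x ∈ K
    · exact hKe h
    · rwa [S.injective (hS _ h)]
  let f : (E ≃ E) → M → M := fun S z => if z ∈ e.source then e.symm (S (e z)) else z
  have hf : ∀ S z, z ∈ e.source → f S z = e.symm (S (e z)) := fun S z hz => if_pos hz
  have hf' : ∀ S z, z ∉ e.source → f S z = z := fun S z hz => if_neg hz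
  have hinv : ∀ S : E ≃ E, (∀ x ∉ K, S x = x) → ∀ z, f S.symm (f S z) = z := by
    intro S hS z
    by_cases hz : z ∈ e.source
    · have h := hmaps S hS _ (e.map_source hz)
      rw [hf S z hz, hf _ _ (e.map_target h), e.right_inv h, S.symm_apply_apply, e.left_inv hz]
    · rw [hf' S z hz, hf' _ z hz]
  have hfix : ∀ z ∉ e.symm '' K, f T z = z := by
    intro z hz
    by_cases hs : z ∈ e.source
    · rw [hf T z hs, hTK _ fun h => hz ⟨e z, h, e.left_inv hs⟩, e.left_inv hs]
    · exact hf' T z hs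
  have hKM : IsClosed (e.symm '' K) :=
    (hK.image_of_continuousOn (e.continuousOn_symm.mono hKe)).isClosed
  let η : M ≃ M := ⟨f T, f T.symm, hinv T hTK, fun z => by simpa using hinv T.symm hTsymm z⟩
  have hη : Continuous η := by
    rw [continuous_iff_continuousAt]
    intro z
    by_cases hz : z ∈ e.source
    · have hc : ContinuousOn (fun z => e.symm (T (e z))) e.source :=
        e.continuousOn_symm.comp (hT.comp_continuousOn e.continuousOn)
          fun z hz => hmaps T hTK _ (e.map_source hz)
      refine (hc.continuousAt (e.open_source.mem_nhds hz)).congr ?_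
      filter_upwards [e.open_source.mem_nhds hz] with y hy using (hf T y hy).symm
    · have hz' : z ∉ e.symm '' K := by
        rintro ⟨x, hx, rfl⟩
        exact hz (e.map_target (hKe hx))
      refine continuousAt_id.congr ?_
      filter_upwards [hKM.isOpen_compl.mem_nhds hz'] with y hy using (hfix y hy).symm
  exact ⟨hη.homeoOfEquivCompactToT2, hf T, hfix⟩

/-- Two points of the part `K` of a chart have no coordinate in common. -/
def CoordSeparated {n : ℕ} {M : Type*} [TopologicalSpace M]
    (e : OpenPartialHomeomorph M (EuclideanSpace ℝ (Fin n))) (K : Set (EuclideanSpace ℝ (Fin n)))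
    (x y : M) : Prop :=
  x ∈ e.symm '' K → y ∈ e.symm '' K → ∀ j, e x j ≠ e y j

/-- Inside one chart, finitely many points can be moved to nearby ones by a homeomorphism close to
the identity, if all the coordinates of the points involved are different. -/
lemma exists_homeomorph_move_chart {n : ℕ} (hn : 2 ≤ n) {M : Type*} [MetricSpace M]
    [CompactSpace M] (e : OpenPartialHomeomorph M (EuclideanSpace ℝ (Fin n)))
    (c : EuclideanSpace ℝ (Fin n)) {ρ : ℝ} (hρ : 0 < ρ) (hc : closedBall c (3 * ρ) ⊆ e.target)
    {ε : ℝ} (hε : 0 < ε) :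
    ∃ δ > 0, ∀ {ι : Type} [Finite ι] (a b : ι → M), (∀ i, dist (a i) (b i) < δ) →
      (∀ i, a i = b i ∨ a i ∈ e.symm '' closedBall c ρ ∧ b i ∈ e.symm '' closedBall c ρ) →
      (∀ i j, i ≠ j → CoordSeparated e (closedBall c (3 * ρ)) (a i) (a j)) →
      (∀ i j, i ≠ j → CoordSeparated e (closedBall c (3 * ρ)) (b i) (b j)) →
      ∃ η : M ≃ₜ M, (∀ x, dist (η x) x ≤ ε) ∧ ∀ i, η (a i) = b i := by
  have hC : IsCompact (closedBall c (3 * ρ)) := isCompact_closedBall _ _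
  have hKC : IsCompact (e.symm '' closedBall c (3 * ρ)) :=
    hC.image_of_continuousOn (e.continuousOn_symm.mono hc)
  have hKs : e.symm '' closedBall c (3 * ρ) ⊆ e.source := by
    rintro _ ⟨x, hx, rfl⟩
    exact e.map_target (hc hx)
  obtain ⟨δ₁, hδ₁, H₁⟩ := Metric.uniformContinuousOn_iff.1
    (hC.uniformContinuousOn_of_continuous (e.continuousOn_symm.mono hc)) ε hε
  obtain ⟨δ₂, hδ₂, h₂₁, h₂ρ⟩ : ∃ δ₂ > 0, 3 * δ₂ < δ₁ ∧ 2 * δ₂ < ρ := by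
    refine ⟨min (δ₁ / 4) (ρ / 3), by positivity, ?_, ?_⟩
    · linarith [min_le_left (δ₁ / 4) (ρ / 3)]
    · linarith [min_le_right (δ₁ / 4) (ρ / 3)]
  obtain ⟨δ, hδ, H₂⟩ := Metric.uniformContinuousOn_iff.1
    (hKC.uniformContinuousOn_of_continuous (e.continuousOn.mono hKs)) δ₂ hδ₂
  refine ⟨δ, hδ, fun {ι} _ a b hab hin ha hb => ?_⟩
  have hsub : e.symm '' closedBall c ρ ⊆ e.symm '' closedBall c (3 * ρ) :=
    Set.image_mono (closedBall_subset_closedBall (by linarith))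
  let ι' := {i // a i ∈ e.symm '' closedBall c (3 * ρ)}
  have hbK : ∀ i : ι', b i ∈ e.symm '' closedBall c (3 * ρ) := by
    rintro ⟨i, hi⟩
    rcases hin i with h | h
    · rwa [← h]
    · exact hsub h.2
  obtain ⟨T, hTc, hTd, hTo, hTa⟩ := exists_equiv_move (ι := ι') c hδ₂ h₂ρ
    (j := ⟨0, by omega⟩) (k := ⟨1, by omega⟩) (by simp)
    (a := fun i => e (a i)) (b := fun i => e (b i))
    (fun i => by
      rw [← dist_eq_norm, dist_comm]
      exact (H₂ _ i.2 _ (hbK i) (hab i)).le)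
    (fun i i' h => by
      by_contra hne
      exact ha i i' (fun h => hne (Subtype.ext h)) i.2 i'.2 _ h)
    (fun i i' h => by
      by_contra hne
      exact hb i i' (fun h => hne (Subtype.ext h)) (hbK i) (hbK i') _ h)
    (fun i => by
      refine (hin i).imp (fun h => by rw [h]) fun h => ?_
      obtain ⟨x, hx, hxa⟩ := h.1
      rw [← hxa, e.right_inv (hc (closedBall_subset_closedBall (by linarith) hx))]
      exact hx)
  obtain ⟨η, hη, hηo⟩ := exists_homeomorph_extend e hC hc T hTc hTo
  refine ⟨η, fun z => ?_, fun i => ?_⟩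
  · by_cases hz : z ∈ e.symm '' closedBall c (3 * ρ)
    · obtain ⟨x, hx, rfl⟩ := hz
      rw [hη _ (e.map_target (hc hx)), e.right_inv (hc hx)]
      refine (H₁ _ ?_ _ hx ((hTd x).trans_lt h₂₁)).le
      by_contra h
      rw [T.injective (hTo _ h)] at h
      exact h hx
    · simp [hηo z hz, hε.le]
  · by_cases hi : a i ∈ e.symm '' closedBall c (3 * ρ)
    · rw [hη _ (hKs hi), hTa ⟨i, hi⟩, e.left_inv (hKs (hbK ⟨i, hi⟩))]
    · rw [hηo _ hi]
      exact (hin i).resolve_right fun h => hi (hsub h.1)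

/-- Each point is coordinate separated from almost every point, in the sense of category. -/
lemma eventually_residual_coordSeparated {n : ℕ} {M : Type*} [TopologicalSpace M] [T2Space M]
    (e : OpenPartialHomeomorph M (EuclideanSpace ℝ (Fin n)))
    {K : Set (EuclideanSpace ℝ (Fin n))} (hK : IsCompact K) (hKe : K ⊆ e.target) (x : M) :
    ∀ᶠ y in residual M, CoordSeparated e K x y := by
  have key : ∀ j : Fin n, ∀ᶠ y in residual M, y ∉ e.symm '' (K ∩ {v | v j = e x j}) := by
    intro j
    refine residual_of_dense_open ?_ ?_
    · have : IsCompact (K ∩ {v : EuclideanSpace ℝ (Fin n) | v j = e x j}) :=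
        hK.inter_right (isClosed_eq (by fun_prop) continuous_const)
      exact (this.image_of_continuousOn (e.continuousOn_symm.mono
        (Set.inter_subset_left.trans hKe))).isClosed.isOpen_compl
    · change Dense (e.symm '' (K ∩ {v | v j = e x j}))ᶜ
      rw [← interior_eq_empty_iff_dense_compl, Set.eq_empty_iff_forall_notMem]
      intro y hy
      set U := interior (e.symm '' (K ∩ {v : EuclideanSpace ℝ (Fin n) | v j = e x j}))
      have hU : U ⊆ e.symm '' (K ∩ {v | v j = e x j}) := interior_subset
      have hUs : U ⊆ e.source := by
        intro z hz
        obtain ⟨v, hv, rfl⟩ := hU hz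
        exact e.map_target (hKe hv.1)
      have hopen := (EuclideanSpace.proj (𝕜 := ℝ) j :
        EuclideanSpace ℝ (Fin n) →L[ℝ] ℝ).isOpenMap
          (fun t => ⟨EuclideanSpace.single j t, by simp⟩) _
          (e.isOpen_image_of_subset_source isOpen_interior hUs)
      have hsub : (EuclideanSpace.proj (𝕜 := ℝ) j : EuclideanSpace ℝ (Fin n) →L[ℝ] ℝ) ''
          (e '' U) = {e x j} := by
        have hne : U.Nonempty := ⟨y, hy⟩
        refine ((hne.image e).image _).subset_singleton_iff.1 ?_
        rintro _ ⟨_, ⟨z, hz, rfl⟩, rfl⟩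
        obtain ⟨v, hv, rfl⟩ := hU hz
        rw [e.right_inv (hKe hv.1)]
        exact hv.2
      rw [hsub] at hopen
      exact not_isOpen_singleton _ hopen
  filter_upwards [Filter.eventually_all.2 key] with y hy _ hyK j hj
  obtain ⟨v, hv, rfl⟩ := hyK
  refine hy j ⟨v, ⟨hv, ?_⟩, rfl⟩
  rw [e.right_inv (hKe hv)] at hj
  exact hj.symm

/-- The small finite displacements of a compact manifold of dimension at least two: there is a
symmetric relation, relating each point to almost every point, such that close finite families of
points, any two of which are related, correspond under a homeomorphism close to the identity. -/
lemma exists_relation_move_pairs {n : ℕ} (hn : 2 ≤ n) (M : Type*) [MetricSpace M] [CompactSpace M]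
    [ChartedSpace (EuclideanSpace ℝ (Fin n)) M] :
    ∃ R : M → M → Prop, (∀ x, ∀ᶠ y in residual M, R x y) ∧ (∀ x y, R x y → R y x) ∧
      ∀ ε > (0 : ℝ), ∃ δ > 0, ∀ {ι : Type} [Finite ι] (A : ι → Set M) (a b : ι → M),
        (∀ i, a i ∈ A i) → (∀ i, b i ∈ A i) → (∀ i, dist (a i) (b i) < δ) →
        (∀ i j, i ≠ j → ∀ u ∈ A i, ∀ v ∈ A j, R u v) →
        ∃ η : M ≃ₜ M, (∀ x, dist (η x) x ≤ ε) ∧ ∀ i, η (a i) = b i := by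
  classical
  let e : M → OpenPartialHomeomorph M (EuclideanSpace ℝ (Fin n)) := fun c => chartAt _ c
  have hρ : ∀ c : M, ∃ ρ > 0, closedBall (e c c) (3 * ρ) ⊆ (e c).target := by
    intro c
    obtain ⟨r, hr, h⟩ := nhds_basis_closedBall.mem_iff.1
      ((e c).open_target.mem_nhds ((e c).map_source (mem_chart_source _ c)))
    exact ⟨r / 3, by positivity, by simpa [mul_div_cancel₀] using h⟩
  choose ρ hρ hρe using hρ
  let V : M → Set M := fun c => (e c).source ∩ e c ⁻¹' ball (e c c) (ρ c)
  have hVo : ∀ c, IsOpen (V c) := fun c => (e c).isOpen_inter_preimage isOpen_ball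
  have hVK : ∀ c, V c ⊆ (e c).symm '' closedBall (e c c) (ρ c) := fun c z hz =>
    ⟨e c z, ball_subset_closedBall hz.2, (e c).left_inv hz.1⟩
  obtain ⟨t, ht⟩ := isCompact_univ.elim_finite_subcover V hVo fun c _ =>
    Set.mem_iUnion.2 ⟨c, mem_chart_source _ c, mem_ball_self (hρ c)⟩
  let S : M → M → M → Prop := fun c => CoordSeparated (e c) (closedBall (e c c) (3 * ρ c))
  have stages : ∀ s : Finset M, ∀ ε > (0 : ℝ), ∃ δ > 0, ∀ {ι : Type} [Finite ι]
      (A : ι → Set M) (a b : ι → M),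
      (∀ i, a i ∈ A i) → (∀ i, b i ∈ A i) → (∀ i, dist (a i) (b i) < δ) →
      (∀ i j, i ≠ j → ∀ u ∈ A i, ∀ v ∈ A j, ∀ c ∈ s, S c u v) →
      (∀ i, a i = b i ∨ ∃ c ∈ s, a i ∈ V c ∧ b i ∈ V c) →
      ∃ η : M ≃ₜ M, (∀ x, dist (η x) x ≤ ε) ∧ ∀ i, η (a i) = b i := by
    intro s
    induction s using Finset.induction_on with
    | empty =>
      intro ε hε
      refine ⟨1, one_pos, fun A a b _ _ _ _ h => ⟨Homeomorph.refl M, ?_, ?_⟩⟩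
      · simp [hε.le]
      · simpa using h
    | insert c s _ ih =>
      intro ε hε
      obtain ⟨δ₁, hδ₁, H₁⟩ := ih (ε / 2) (half_pos hε)
      obtain ⟨δ₂, hδ₂, H₂⟩ := exists_homeomorph_move_chart hn (e c) (e c c) (hρ c) (hρe c)
        (half_pos hε)
      refine ⟨min δ₁ δ₂, lt_min hδ₁ hδ₂, fun {ι} _ A a b ha hb hab hA hc => ?_⟩
      let w : ι → M := fun i => if a i ∈ V c ∧ b i ∈ V c then b i else a i
      have hw : ∀ i, w i = b i ∧ a i ∈ V c ∧ b i ∈ V c ∨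
          w i = a i ∧ ¬ (a i ∈ V c ∧ b i ∈ V c) := by
        intro i
        by_cases h : a i ∈ V c ∧ b i ∈ V c
        · exact .inl ⟨if_pos h, h⟩
        · exact .inr ⟨if_neg h, h⟩
      have hwA : ∀ i, w i ∈ A i := by
        intro i
        rcases hw i with ⟨h, -⟩ | ⟨h, -⟩ <;> rw [h]
        exacts [hb i, ha i]
      have hS := fun i j hij u hu v hv => hA i j hij u hu v hv c (Finset.mem_insert_self _ _)
      obtain ⟨η₂, hη₂, hη₂a⟩ := H₂ a w
        (fun i => by
          rcases hw i with ⟨h, -⟩ | ⟨h, -⟩ <;> rw [h]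
          · exact (hab i).trans_le (min_le_right _ _)
          · simpa using hδ₂)
        (fun i => by
          rcases hw i with ⟨h, h'⟩ | ⟨h, -⟩ <;> rw [h]
          · exact .inr ⟨hVK c h'.1, hVK c h'.2⟩
          · exact .inl rfl)
        (fun i j hij => hS i j hij _ (ha i) _ (ha j))
        (fun i j hij => hS i j hij _ (hwA i) _ (hwA j))
      obtain ⟨η₁, hη₁, hη₁a⟩ := H₁ A w b hwA hb
        (fun i => by
          rcases hw i with ⟨h, -⟩ | ⟨h, -⟩ <;> rw [h]
          · simpa using hδ₁
          · exact (hab i).trans_le (min_le_left _ _))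
        (fun i j hij u hu v hv c' hc' => hA i j hij u hu v hv c' (Finset.mem_insert_of_mem hc'))
        (fun i => by
          rcases hw i with ⟨h, -⟩ | ⟨h, h'⟩ <;> rw [h]
          · exact .inl rfl
          · refine (hc i).imp_right ?_
            rintro ⟨c', hc', h''⟩
            rcases Finset.mem_insert.1 hc' with rfl | hc'
            · exact absurd h'' h'
            · exact ⟨c', hc', h''⟩)
      refine ⟨η₂.trans η₁, fun x => ?_, fun i => ?_⟩
      · have := dist_triangle (η₁ (η₂ x)) (η₂ x) x
        have := hη₁ (η₂ x)
        have := hη₂ x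
        simp only [Homeomorph.trans_apply]
        linarith
      · simp [hη₂a, hη₁a]
  refine ⟨fun x y => ∀ c ∈ t, S c x y, fun x => ?_, fun x y h c hc hy hx j => ?_, fun ε hε => ?_⟩
  · rw [Filter.eventually_all_finset]
    exact fun c _ => eventually_residual_coordSeparated (e c) (isCompact_closedBall _ _) (hρe c) x
  · exact (h c hc hx hy j).symm
  · obtain ⟨δ, hδ, H⟩ := stages t ε hε
    obtain ⟨δ', hδ', H'⟩ := lebesgue_number_lemma_of_metric isCompact_univ
      (fun c : t => hVo c) fun z hz => by
        obtain ⟨c, hc, h⟩ := Set.mem_iUnion₂.1 (ht hz)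
        exact Set.mem_iUnion.2 ⟨⟨c, hc⟩, h⟩
    refine ⟨min δ δ', lt_min hδ hδ', fun A a b ha hb hab hA => ?_⟩
    refine H A a b ha hb (fun i => (hab i).trans_le (min_le_left _ _)) hA fun i => .inr ?_
    obtain ⟨c, hc⟩ := H' (a i) (Set.mem_univ _)
    refine ⟨c, c.2, hc (mem_ball_self hδ'), hc ?_⟩
    rw [mem_ball, dist_comm]
    exact (hab i).trans_le (min_le_right _ _)

/-- A sequence can be perturbed so as to satisfy countably many generic conditions, each involving
at most two terms. -/
lemma exists_generic_seq {M : Type*} [MetricSpace M] [BaireSpace M] {S : ℕ → M → Prop}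
    (hS : ∀ k, ∀ᶠ y in residual M, S k y) {R : ℕ → ℕ → M → M → Prop}
    (hR : ∀ j k x, ∀ᶠ y in residual M, R j k x y) (z : ℕ → M) {ε : ℝ} (hε : 0 < ε) :
    ∃ y : ℕ → M, (∀ k, dist (y k) (z k) < ε) ∧ (∀ k, S k (y k)) ∧
      ∀ j k, j < k → R j k (y j) (y k) := by
  have step : ∀ (k : ℕ) (y : ∀ j < k, M),
      ∃ u, dist u (z k) < ε ∧ S k u ∧ ∀ j (h : j < k), R j k (y j h) u := by
    intro k y
    have h : ∀ᶠ u in residual M, S k u ∧ ∀ j (h : j < k), R j k (y j h) u :=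
      (hS k).and (eventually_countable_forall.2 fun j => eventually_countable_forall.2 fun h =>
        hR j k (y j h))
    obtain ⟨u, hu, hd⟩ := (dense_of_mem_residual h).exists_dist_lt (z k) hε
    exact ⟨u, by rwa [dist_comm], hu⟩
  choose g hg using step
  let y : ℕ → M := fun k => Nat.strongRecOn k g
  have hy : ∀ k, y k = g k fun j _ => y j := fun k => Nat.strongRecOn_eq g k
  refine ⟨y, fun k => ?_, fun k => ?_, fun j k hjk => ?_⟩
  · rw [hy k]
    exact (hg k _).1
  · rw [hy k]
    exact (hg k _).2.1
  · rw [hy k]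
    exact (hg k fun j _ => y j).2.2 j hjk

/-- On a compact manifold of dimension at least two, finitely many generic points can be moved to
nearby generic points by a homeomorphism close to the identity. -/
lemma exists_relation_move_seq {n : ℕ} (hn : 2 ≤ n) (M : Type*) [MetricSpace M] [CompactSpace M]
    [ChartedSpace (EuclideanSpace ℝ (Fin n)) M] :
    ∃ R : M → M → Prop, (∀ x, ∀ᶠ y in residual M, R x y) ∧
      ∀ ε > (0 : ℝ), ∃ δ > 0, ∀ (m : ℕ) (p q : ℕ → M), (∀ i, dist (p i) (q i) < δ) →
        (∀ i j, i < j → R (p i) (p j)) → (∀ i j, i < j → R (q i) (q j)) →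
        ∃ η : M ≃ₜ M, (∀ x, dist (η x) x ≤ ε) ∧ ∀ i < m, η (p i) = q i := by
  obtain ⟨R, hR, hsymm, H⟩ := exists_relation_move_pairs hn M
  refine ⟨R, hR, fun ε hε => ?_⟩
  obtain ⟨δ, hδ, H⟩ := H (ε / 2) (half_pos hε)
  refine ⟨δ / 2, half_pos hδ, fun m p q hpq hp hq => ?_⟩
  obtain ⟨r, hrq, hr, hrr⟩ := exists_generic_seq (S := fun _ u => ∀ i, R (p i) u ∧ R (q i) u)
    (R := fun _ _ => R)
    (fun _ => eventually_countable_forall.2 fun i => (hR (p i)).and (hR (q i)))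
    (fun _ _ => hR) q (half_pos hδ)
  have hne : ∀ f : ℕ → M, (∀ i j, i < j → R (f i) (f j)) → ∀ i j, i ≠ j → R (f i) (f j) := by
    intro f hf i j hij
    rcases hij.lt_or_gt with h | h
    exacts [hf i j h, hsymm _ _ (hf j i h)]
  have move : ∀ f : ℕ → M, (∀ i j, i < j → R (f i) (f j)) → (∀ i j, R (f i) (r j)) →
      ∀ i j : Fin m, i ≠ j → ∀ u ∈ ({f i, r i} : Set M), ∀ v ∈ ({f j, r j} : Set M), R u v := by
    intro f hf hfr i j hij u hu v hv
    have hij' : (i : ℕ) ≠ j := fun h => hij (Fin.ext h)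
    rcases hu with rfl | rfl <;> rcases hv with rfl | rfl
    exacts [hne f hf _ _ hij', hfr _ _, hsymm _ _ (hfr _ _), hne r hrr _ _ hij']
  obtain ⟨η₁, hη₁, hη₁p⟩ := H (fun i : Fin m => {p i, r i}) (fun i => p i) (fun i => r i)
    (by simp) (by simp)
    (fun i => by
      have := dist_triangle_right (p i) (r i) (q i)
      have := hpq i
      have := hrq i
      linarith)
    (move p hp fun i j => (hr j i).1)
  obtain ⟨η₂, hη₂, hη₂r⟩ := H (fun i : Fin m => {q i, r i}) (fun i => r i) (fun i => q i)
    (by simp) (by simp) (fun i => (hrq i).trans (half_lt_self hδ))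
    (move q hq fun i j => (hr j i).2)
  refine ⟨η₁.trans η₂, fun x => ?_, fun i hi => ?_⟩
  · have := dist_triangle (η₂ (η₁ x)) (η₁ x) x
    have := hη₁ x
    have := hη₂ (η₁ x)
    simp only [Homeomorph.trans_apply]
    linarith
  · have h₁ := hη₁p ⟨i, hi⟩
    have h₂ := hη₂r ⟨i, hi⟩
    simp only at h₁ h₂
    rw [Homeomorph.trans_apply, h₁, h₂]

lemma ifsComp_add_one {M : Type*} [TopologicalSpace M] {Λ : Type*} (F : Λ → M ≃ₜ M) (σ : ℤ → Λ)
    (k : ℤ) (w : M) : ifsComp F σ (k + 1) w = F (σ k) (ifsComp F σ k w) := by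
  rcases k with k | k
  · rfl
  · rcases k with _ | k
    · simp [ifsComp, fwdComp, bwdComp]
    · have h : Int.negSucc (k + 1) + 1 = Int.negSucc k := by lia
      have hσ : (-((k + 1 : ℕ) + 1 : ℤ)) = Int.negSucc (k + 1) := by lia
      rw [h]
      change _ = F _ ((F (σ (-((k + 1 : ℕ) + 1 : ℤ)))).symm (bwdComp F σ (k + 1) w))
      rw [hσ, Homeomorph.apply_symm_apply]
      rfl

lemma fwdComp_eq_of_orbit {M : Type*} [TopologicalSpace M] {Λ : Type*} (G : Λ → M ≃ₜ M)
    (σ : ℤ → Λ) (y : ℕ → M) (m : ℕ) (hy : ∀ k < m, y (k + 1) = G (σ k) (y k)) :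
    ∀ k ≤ m, fwdComp G σ k (y 0) = y k := by
  intro k
  induction k with
  | zero => simp [fwdComp]
  | succ k ih =>
    intro hk
    rw [hy k hk, ← ih (Nat.le_of_succ_le hk)]
    rfl

/-- Composing a finite IFS with homeomorphisms close to the identity is a small perturbation. -/
lemma exists_D0_trans_lt {M : Type*} [MetricSpace M] [CompactSpace M] [Nonempty M] {Λ : Type*}
    [Finite Λ] [Nonempty Λ] (F : Λ → M ≃ₜ M) {δ : ℝ} (hδ : 0 < δ) :
    ∃ α > 0, ∀ η : M ≃ₜ M, (∀ x, dist (η x) x ≤ α) → D0 F (fun l => (F l).trans η) < δ := by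
  have hu : ∀ l, ∃ α > 0, ∀ x y, dist x y < α → dist ((F l).symm x) ((F l).symm y) < δ / 2 :=
    fun l => by
      obtain ⟨α, hα, h⟩ := Metric.uniformContinuous_iff.1
        (CompactSpace.uniformContinuous_of_continuous (F l).symm.continuous) (δ / 2) (half_pos hδ)
      exact ⟨α, hα, fun x y hxy => h hxy⟩
  choose α hα h using hu
  obtain ⟨l₀, hl₀⟩ := Finite.exists_min α
  refine ⟨min (α l₀) δ / 2, half_pos (lt_min (hα l₀) hδ), fun η hη => ?_⟩
  refine (ciSup_le fun l => ciSup_le fun x => max_le ?_ ?_ : _ ≤ δ / 2).trans_lt (half_lt_self hδ)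
  · rw [dist_comm]
    have := hη (F l x)
    have := min_le_right (α l₀) δ
    simp only [Homeomorph.trans_apply]
    linarith
  · refine (h l x (η.symm x) ?_).le
    have h₁ := hη (η.symm x)
    rw [Homeomorph.apply_symm_apply] at h₁
    have := min_le_left (α l₀) δ
    have := hα l₀
    have := hl₀ l
    linarith

/-- One-sided chains of a topologically stable IFS are shadowed for arbitrarily long finite times. -/
lemma finite_shadowing {n : ℕ} (hn : 2 ≤ n) {M : Type*} [MetricSpace M] [CompactSpace M]
    [Nonempty M] [ChartedSpace (EuclideanSpace ℝ (Fin n)) M] {Λ : Type*} [Finite Λ] [Nonempty Λ]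
    (F : Λ → M ≃ₜ M)
    (hTS : ∀ ε > (0 : ℝ), ∃ δ > (0 : ℝ), ∀ G : Λ → M ≃ₜ M, D0 F G < δ →
      ∀ σ : ℤ → Λ, ∃ h : M → M, Continuous h ∧ Function.Surjective h ∧
        (∀ k : ℤ, (ifsComp F σ k) ∘ h = h ∘ (ifsComp G σ k)) ∧
        ∀ x : M, dist x (h x) < ε) {ε : ℝ} (hε : 0 < ε) :
    ∃ δ > 0, ∀ (x : ℕ → M) (σ : ℤ → Λ), (∀ k : ℕ, dist (x (k + 1)) (F (σ k) (x k)) ≤ δ) →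
      ∀ m : ℕ, ∃ w : M, ∀ k ≤ m, dist (x k) (fwdComp F σ k w) ≤ ε := by
  obtain ⟨δ₁, hδ₁, H₁⟩ := hTS (ε / 2) (half_pos hε)
  obtain ⟨α, hα, hD⟩ := exists_D0_trans_lt F hδ₁
  obtain ⟨R, hR, H₂⟩ := exists_relation_move_seq hn M
  obtain ⟨δ₂, hδ₂, H₂⟩ := H₂ α hα
  have hu : ∀ l, ∃ β > 0, ∀ x y, dist x y < β → dist (F l x) (F l y) < δ₂ / 3 := fun l => by
    obtain ⟨β, hβ, h⟩ := Metric.uniformContinuous_iff.1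
      (CompactSpace.uniformContinuous_of_continuous (F l).continuous) (δ₂ / 3) (by positivity)
    exact ⟨β, hβ, fun x y hxy => h hxy⟩
  choose β hβ hF using hu
  obtain ⟨l₀, hl₀⟩ := Finite.exists_min β
  refine ⟨δ₂ / 3, by positivity, fun x σ hx m => ?_⟩
  obtain ⟨y, hyx, -, hyR⟩ := exists_generic_seq (S := fun _ _ => True) (by simp)
    (R := fun j k u v => R u v ∧ R (F (σ j) u) (F (σ k) v))
    (fun j k u => (hR u).and ((tendsto_residual_of_isOpenMap (F (σ k)).continuous
      (F (σ k)).isOpenMap).eventually (hR (F (σ j) u))))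
    x (ε := min (min (ε / 2) (δ₂ / 3)) (β l₀))
    (lt_min (lt_min (half_pos hε) (by positivity)) (hβ l₀))
  simp only [lt_min_iff] at hyx
  obtain ⟨η, hη, hηy⟩ := H₂ m (fun k => F (σ k) (y k)) (fun k => y (k + 1))
    (fun k => by
      have h₁ := hF (σ k) _ _ ((hyx k).2.trans_le (hl₀ _))
      have h₂ := hx k
      have h₃ := (hyx (k + 1)).1.2
      have h₄ := dist_triangle4 (F (σ k) (y k)) (F (σ k) (x k)) (x (k + 1)) (y (k + 1))
      rw [dist_comm] at h₂ h₃
      linarith)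
    (fun i j hij => (hyR i j hij).2) (fun i j hij => (hyR _ _ (Nat.succ_lt_succ hij)).1)
  obtain ⟨h, -, -, hh, hhd⟩ := H₁ _ (hD η hη) σ
  refine ⟨h (y 0), fun k hk => ?_⟩
  have h₁ : fwdComp F σ k (h (y 0)) = h (fwdComp (fun l => (F l).trans η) σ k (y 0)) :=
    congr_fun (hh k) (y 0)
  rw [h₁, fwdComp_eq_of_orbit _ σ y m (fun k hk => (hηy k hk).symm) k hk]
  have h₂ := (hyx k).1.1
  have h₃ := dist_triangle_left (x k) (h (y k)) (y k)
  have h₄ := hhd (y k)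
  linarith

/-- On a closed manifold of dimension ≥ 2, a topologically stable IFS of
homeomorphisms has the shadowing property. -/
theorem topologically_stable_implies_shadowing
    {n : ℕ} (hn : 2 ≤ n)
    {M : Type*} [MetricSpace M] [CompactSpace M] [Nonempty M]
    [ChartedSpace (EuclideanSpace ℝ (Fin n)) M]
    {Λ : Type*} [Finite Λ] [Nonempty Λ]
    (F : Λ → M ≃ₜ M)
    (hTS : ∀ ε > (0 : ℝ), ∃ δ > (0 : ℝ), ∀ G : Λ → M ≃ₜ M, D0 F G < δ →
      ∀ σ : ℤ → Λ, ∃ h : M → M, Continuous h ∧ Function.Surjective h ∧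
        (∀ k : ℤ, (ifsComp F σ k) ∘ h = h ∘ (ifsComp G σ k)) ∧
        ∀ x : M, dist x (h x) < ε) :
    ∀ ε > (0 : ℝ), ∃ δ > (0 : ℝ), ∀ (x : ℤ → M) (σ : ℤ → Λ),
      (∀ k : ℤ, dist (x (k + 1)) (F (σ k) (x k)) ≤ δ) →
      ∃ (y : ℤ → M) (τ : ℤ → Λ),
        (∀ k : ℤ, y (k + 1) = F (τ k) (y k)) ∧ ∀ k : ℤ, dist (x k) (y k) ≤ ε := by
  intro ε hε
  obtain ⟨δ, hδ, H⟩ := finite_shadowing hn F hTS hε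
  refine ⟨δ, hδ, fun x σ hx => ?_⟩
  let B : ℕ → Set M := fun N =>
    ⋂ k : Set.Icc (-N : ℤ) N, {w | dist (x k) (ifsComp F σ k w) ≤ ε}
  have hB : ∀ N, IsClosed (B N) := fun N => isClosed_iInter fun k =>
    isClosed_le (continuous_const.dist (ifsComp F σ k).continuous) continuous_const
  have hne : ∀ N, (B N).Nonempty := by
    intro N
    obtain ⟨w, hw⟩ := H (fun k => x (k - N)) (fun k => σ (k - N))
      (fun k => by simpa [sub_add_eq_add_sub] using hx (k - N)) (2 * N)
    have horb : ∀ k : ℕ, fwdComp F (fun k => σ (k - N)) k w =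
        ifsComp F σ (k - N) ((ifsComp F σ (-N)).symm w) := by
      intro k
      induction k with
      | zero => simp [fwdComp]
      | succ k ih =>
        have : ((k + 1 : ℕ) : ℤ) - N = (k - N) + 1 := by push_cast; ring
        rw [this, ifsComp_add_one, ← ih]
        rfl
    refine ⟨(ifsComp F σ (-N)).symm w, Set.mem_iInter.2 fun ⟨k, hk⟩ => ?_⟩
    obtain ⟨j, hj⟩ := Int.eq_ofNat_of_zero_le (show 0 ≤ k + N by linarith [hk.1])
    obtain rfl : k = j - N := by linarith
    have := hw j (by have := hk.2; omega)
    rwa [horb] at this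
  obtain ⟨w, hw⟩ := IsCompact.nonempty_iInter_of_sequence_nonempty_isCompact_isClosed B
    (fun N v hv => Set.mem_iInter.2 fun ⟨k, hk⟩ =>
      Set.mem_iInter.1 hv ⟨k, by have := hk.1; have := hk.2; constructor <;> push_cast <;> omega⟩)
    hne (hB 0).isCompact hB
  refine ⟨fun k => ifsComp F σ k w, σ, fun k => ifsComp_add_one F σ k w, fun k => ?_⟩
  exact Set.mem_iInter.1 (Set.mem_iInter.1 hw k.natAbs)
    ⟨k, by constructor <;> omega⟩
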